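/- arXiv:2401.03662 — 2 statements merged into one kernel-verified Lean document; each statement's English description precedes it below -/
import Mathlib

section
/- Let d : ℝ³ → ℝ³ be smooth and ℤ³-periodic, and set f(p)=(|p|²−1)p (the gradient of ¼(|p|²−1)²). Then ∫_{[0,1]³}|Δd−f(d)|² dx = ∫_{[0,1]³}(|Δd|² + |f(d)|² + 2|d|²|∇d|² + 4|(∇d)ᵀd|²) dx − 2∫_{[0,1]³}|∇d|² dx. -/
open MeasureTheory

/-- Partial derivative in direction `i` of a scalar function on `ℝ³`. -/
noncomputable def pd (i : Fin 3) (g : (Fin 3 → ℝ) → ℝ) (x : Fin 3 → ℝ) : ℝ :=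
  fderiv ℝ g x (Pi.single i 1)

/-- The unit-cube integral of a partial derivative of a periodic smooth function vanishes. -/
theorem setIntegral_pd_eq_zero {V : (Fin 3 → ℝ) → ℝ} (hV : ContDiff ℝ (⊤ : ℕ∞) V)
    (hper : ∀ (x : Fin 3 → ℝ) (n : Fin 3 → ℤ), V (x + fun i => (n i : ℝ)) = V x) (j : Fin 3) :
    ∫ x in Set.Icc (0 : Fin 3 → ℝ) 1, pd j V x = 0 := by
  have hVd : Differentiable ℝ V := hV.differentiable (by simp)
  have hcont : Continuous (pd j V) := (hV.continuous_fderiv (by simp)).clm_apply continuous_const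
  have key := integral_divergence_of_hasFDerivAt_off_countable' (n := 2) (0 : Fin 3 → ℝ) 1
    zero_le_one (fun i x => if i = j then V x else 0)
    (fun i x => if i = j then fderiv ℝ V x else 0) ∅ Set.countable_empty
    (fun i => by
      by_cases h : i = j
      · simpa [h] using hVd.continuous.continuousOn
      · simpa [h] using continuousOn_const)
    (fun x _ i => by
      by_cases h : i = j
      · simpa [h] using (hVd x).hasFDerivAt
      · simpa [h] using hasFDerivAt_const (0 : ℝ) x)
    (by
      refine ContinuousOn.integrableOn_compact isCompact_Icc (Continuous.continuousOn ?_)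
      convert hcont using 2 with x
      rw [Finset.sum_eq_single j]
      · simp [pd]
      · intro i _ h
        simp [h]
      · simp)
  have hsum : ∀ x, (∑ i : Fin 3, (if i = j then fderiv ℝ V x else 0) (Pi.single i 1))
      = pd j V x := fun x => by
    rw [Finset.sum_eq_single j]
    · simp [pd]
    · intro i _ h
      simp [h]
    · simp
  simp only [hsum] at key
  rw [key]
  refine Finset.sum_eq_zero fun i _ => ?_
  rw [sub_eq_zero]
  refine integral_congr_ae (Filter.Eventually.of_forall fun y => ?_)
  have hface : i.insertNth (1 : ℝ) y
      = i.insertNth (0 : ℝ) y + fun k => ((Pi.single i (1 : ℤ) : Fin 3 → ℤ) k : ℝ) := by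
    ext k
    refine i.succAboveCases ?_ (fun l => ?_) k <;> simp
  have hface' : V (i.insertNth (1 : ℝ) y) = V (i.insertNth (0 : ℝ) y) := by
    rw [hface, hper]
  by_cases h : i = j
  · simpa [h] using h ▸ hface'
  · simp [h]

theorem contDiff_pd {g : (Fin 3 → ℝ) → ℝ} (hg : ContDiff ℝ (⊤ : ℕ∞) g) (i : Fin 3) :
    ContDiff ℝ (⊤ : ℕ∞) (pd i g) :=
  (hg.fderiv_right (m := (⊤ : ℕ∞)) (by simp)).clm_apply contDiff_const

theorem pd_periodic {g : (Fin 3 → ℝ) → ℝ} {a : Fin 3 → ℝ} (hg : ∀ x, g (x + a) = g x)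
    (i : Fin 3) (x : Fin 3 → ℝ) : pd i g (x + a) = pd i g x := by
  unfold pd
  rw [← fderiv_comp_add_right]
  simp only [hg]

section Algebra

variable {g h : (Fin 3 → ℝ) → ℝ} {x : Fin 3 → ℝ}

theorem pd_mul (hg : DifferentiableAt ℝ g x) (hh : DifferentiableAt ℝ h x) (i : Fin 3) :
    pd i (fun z => g z * h z) x = pd i g x * h x + g x * pd i h x := by
  simp only [pd, fderiv_fun_mul hg hh, add_apply, FunLike.coe_smul, Pi.smul_apply, smul_eq_mul]
  ring

theorem pd_sum {u : Fin 3 → (Fin 3 → ℝ) → ℝ} (hu : ∀ k, DifferentiableAt ℝ (u k) x) (i : Fin 3) :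
    pd i (fun z => ∑ k, u k z) x = ∑ k, pd i (u k) x := by
  simp [pd, fderiv_fun_sum fun k _ => hu k]

theorem pd_sub_const (c : ℝ) (i : Fin 3) :
    pd i (fun z => g z - c) x = pd i g x := by
  simp only [pd, fderiv_sub_const]

end Algebra

/-- For a smooth `ℤ³`-periodic map `d : ℝ³ → ℝ³` and `f(p) = (|p|²-1)p`,
`∫_{[0,1]³} |Δd - f(d)|² = ∫_{[0,1]³} (|Δd|² + |f(d)|² + 2|d|²|∇d|² + 4|(∇d)ᵀd|²)
  − 2 ∫_{[0,1]³} |∇d|²`. -/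
theorem rearranged_tension_identity
    (d : (Fin 3 → ℝ) → (Fin 3 → ℝ)) (hd : ContDiff ℝ (⊤ : ℕ∞) d)
    (hper : ∀ (x : Fin 3 → ℝ) (n : Fin 3 → ℤ), d (x + fun i => (n i : ℝ)) = d x) :
    (∫ x in Set.Icc (0 : Fin 3 → ℝ) 1,
        ∑ k : Fin 3,
          ((∑ i : Fin 3, pd i (pd i (fun z => d z k)) x)
            - ((∑ m : Fin 3, (d x m) ^ 2) - 1) * d x k) ^ 2)
    = (∫ x in Set.Icc (0 : Fin 3 → ℝ) 1,
        ((∑ k : Fin 3, (∑ i : Fin 3, pd i (pd i (fun z => d z k)) x) ^ 2)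
          + (∑ k : Fin 3, (((∑ m : Fin 3, (d x m) ^ 2) - 1) * d x k) ^ 2)
          + 2 * (∑ m : Fin 3, (d x m) ^ 2) *
              (∑ i : Fin 3, ∑ k : Fin 3, (pd i (fun z => d z k) x) ^ 2)
          + 4 * ∑ i : Fin 3, (∑ k : Fin 3, d x k * pd i (fun z => d z k) x) ^ 2))
      - 2 * ∫ x in Set.Icc (0 : Fin 3 → ℝ) 1,
          ∑ i : Fin 3, ∑ k : Fin 3, (pd i (fun z => d z k) x) ^ 2 := by
  have hk : ∀ k, ContDiff ℝ (⊤ : ℕ∞) (fun z => d z k) := contDiff_pi.1 hd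
  have hpk : ∀ i k, ContDiff ℝ (⊤ : ℕ∞) (pd i (fun z => d z k)) := fun i k => contDiff_pd (hk k) i
  have hN : ContDiff ℝ (⊤ : ℕ∞) (fun z => (∑ m : Fin 3, (d z m) ^ 2) - 1) :=
    (ContDiff.sum fun m _ => (hk m).pow 2).sub contDiff_const
  have hterm : ∀ i k, ContDiff ℝ (⊤ : ℕ∞)
      (fun z => ((∑ m : Fin 3, (d z m) ^ 2) - 1) * d z k * pd i (fun z => d z k) z) :=
    fun i k => (hN.mul (hk k)).mul (hpk i k)
  let V : Fin 3 → (Fin 3 → ℝ) → ℝ := fun i z =>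
    ∑ k : Fin 3, ((∑ m : Fin 3, (d z m) ^ 2) - 1) * d z k * pd i (fun z => d z k) z
  have hV : ∀ i, ContDiff ℝ (⊤ : ℕ∞) (V i) := fun i => ContDiff.sum fun k _ => hterm i k
  have hVper : ∀ i (x : Fin 3 → ℝ) (n : Fin 3 → ℤ), V i (x + fun i => (n i : ℝ)) = V i x := by
    intro i x n
    have h : ∀ k, pd i (fun z => d z k) (x + fun i => (n i : ℝ)) = pd i (fun z => d z k) x :=
      fun k => pd_periodic (fun y => by rw [hper]) i x
    simp only [V, h, hper]
  have hdk : ∀ k, Differentiable ℝ (fun z => d z k) := fun k => (hk k).differentiable (by simp)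
  have hNd : Differentiable ℝ (fun z => (∑ m : Fin 3, (d z m) ^ 2) - 1) :=
    hN.differentiable (by simp)
  have hpdN : ∀ i x, pd i (fun z => (∑ m : Fin 3, (d z m) ^ 2) - 1) x
      = ∑ m, 2 * (d x m * pd i (fun z => d z m) x) := by
    intro i x
    rw [pd_sub_const, pd_sum fun m => ((hdk m).fun_pow 2) x]
    refine Finset.sum_congr rfl fun m _ => ?_
    simp only [pow_two]
    rw [pd_mul (hdk m x) (hdk m x)]
    ring
  have hpdV : ∀ i x, pd i (V i) x = ∑ k,
      (((∑ m, 2 * (d x m * pd i (fun z => d z m) x)) * d x k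
        + ((∑ m : Fin 3, (d x m) ^ 2) - 1) * pd i (fun z => d z k) x) * pd i (fun z => d z k) x
      + ((∑ m : Fin 3, (d x m) ^ 2) - 1) * d x k * pd i (pd i (fun z => d z k)) x) := by
    intro i x
    rw [pd_sum fun k => (hterm i k).differentiable (by simp) x]
    refine Finset.sum_congr rfl fun k _ => ?_
    rw [pd_mul ((hNd x).fun_mul (hdk k x)) ((hpk i k).differentiable (by simp) x),
      pd_mul (hNd x) (hdk k x), hpdN]
  have hcd : ∀ k, Continuous fun z => d z k := fun k => (hk k).continuous
  have hcp : ∀ i k, Continuous (pd i (fun z => d z k)) := fun i k => (hpk i k).continuous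
  have hcpp : ∀ i k, Continuous (pd i (pd i (fun z => d z k))) :=
    fun i k => (contDiff_pd (hpk i k) i).continuous
  have hint : ∀ {F : (Fin 3 → ℝ) → ℝ}, Continuous F →
      IntegrableOn F (Set.Icc (0 : Fin 3 → ℝ) 1) :=
    fun hF => hF.continuousOn.integrableOn_compact isCompact_Icc
  have hdiv : ∫ x in Set.Icc (0 : Fin 3 → ℝ) 1, ∑ i, pd i (V i) x = 0 := by
    rw [integral_finsetSum _ fun i _ => hint (contDiff_pd (hV i) i).continuous]
    exact Finset.sum_eq_zero fun i _ => setIntegral_pd_eq_zero (hV i) (hVper i) i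
  have hdivint : IntegrableOn (fun x => ∑ i, pd i (V i) x) (Set.Icc (0 : Fin 3 → ℝ) 1) :=
    hint (continuous_finsetSum _ fun i _ => (contDiff_pd (hV i) i).continuous)
  rw [← integral_const_mul, ← integral_sub (hint (by fun_prop)) (hint (by fun_prop)),
    ← sub_zero (∫ x in Set.Icc (0 : Fin 3 → ℝ) 1, (_ - _ : ℝ)), ← mul_zero (2 : ℝ), ← hdiv,
    ← integral_const_mul, ← integral_sub (hint (by fun_prop)) (hdivint.const_mul 2)]
  refine integral_congr_ae (Filter.Eventually.of_forall fun x => ?_)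
  simp only [hpdV, Fin.sum_univ_three]
  ring
end

section
/- Let T>0 and let u : ℝ³×[0,T] → ℝ³ and d : ℝ³×[0,T] → ℝ³ be smooth and ℤ³-periodic in the space variable, with div u(·,t) = 0 for every t. Suppose d solves the transported Ginzburg–Landau heat flow ∂_t d + u·∇d = Δd − (|d|²−1)d on ℝ³×(0,T], and that |d(x,0)| ≤ 1 for every x ∈ ℝ³. Then |d(x,t)| ≤ 1 for every (x,t) ∈ ℝ³×[0,T]. -/
open MeasureTheory

/-- The second derivative of a real function is nonpositive at a local maximum. -/
theorem deriv_deriv_nonpos_of_isLocalMax {g : ℝ → ℝ} {a : ℝ} (hg : ContinuousAt g a)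
    (h : IsLocalMax g a) : deriv (deriv g) a ≤ 0 := by
  by_contra! hpos
  have hmin : IsLocalMin g a := isLocalMin_of_deriv_deriv_pos hpos h.deriv_eq_zero hg
  have hconst : g =ᶠ[nhds a] fun _ => g a := by
    filter_upwards [h, hmin] with s h₁ h₂ using le_antisymm h₁ h₂
  have hzero : deriv (deriv g) a = 0 := by
    rw [hconst.deriv.deriv_eq]
    simp
  exact hpos.ne' hzero

/-- The derivative is nonnegative at a point where the maximum from the left is attained. -/
theorem deriv_nonneg_of_forall_le_left {g : ℝ → ℝ} {a b : ℝ} (hb : b < a)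
    (hg : DifferentiableAt ℝ g a) (h : ∀ s ∈ Set.Ioo b a, g s ≤ g a) : 0 ≤ deriv g a := by
  have ht := hasDerivWithinAt_iff_tendsto_slope' (s := Set.Iio a) (by simp) |>.1
    hg.hasDerivAt.hasDerivWithinAt
  refine ge_of_tendsto ht ?_
  filter_upwards [Ioo_mem_nhdsLT hb] with s hs
  rw [slope_def_field]
  exact div_nonneg_of_nonpos (by linarith [h s hs]) (by linarith [hs.2])

theorem hasDerivAt_comp_line {f : (Fin 3 → ℝ) → ℝ} (hf : Differentiable ℝ f) (i : Fin 3)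
    (x : Fin 3 → ℝ) (s : ℝ) :
    HasDerivAt (fun s : ℝ => f (x + s • Pi.single i 1)) (pd i f (x + s • Pi.single i 1)) s := by
  have hline : HasDerivAt (fun s : ℝ => x + s • (Pi.single i 1 : Fin 3 → ℝ))
      (Pi.single i 1) s := by
    simpa using ((hasDerivAt_id s).smul_const (Pi.single i 1 : Fin 3 → ℝ)).const_add x
  exact (hf _).hasFDerivAt.comp_hasDerivAt s hline

theorem differentiable_pd {f : (Fin 3 → ℝ) → ℝ} (hf : ContDiff ℝ 2 f) (i : Fin 3) :
    Differentiable ℝ (pd i f) := by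
  have h : Differentiable ℝ (fderiv ℝ f) :=
    (hf.fderiv_right (m := 1) (by norm_num)).differentiable (by norm_num)
  exact h.clm_apply (differentiable_const _)

theorem pd_eq_zero_of_forall_le {f : (Fin 3 → ℝ) → ℝ} {x : Fin 3 → ℝ}
    (h : ∀ y, f y ≤ f x) (i : Fin 3) : pd i f x = 0 := by
  have hx : IsLocalMax f x := Filter.Eventually.of_forall h
  simp [pd, hx.fderiv_eq_zero]

theorem pd_pd_nonpos_of_forall_le {f : (Fin 3 → ℝ) → ℝ} (hf : ContDiff ℝ 2 f)
    {x : Fin 3 → ℝ} (h : ∀ y, f y ≤ f x) (i : Fin 3) : pd i (pd i f) x ≤ 0 := by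
  have hline := hasDerivAt_comp_line (hf.differentiable (by norm_num)) i x
  have hmax : IsLocalMax (fun s : ℝ => f (x + s • Pi.single i 1)) 0 :=
    Filter.Eventually.of_forall fun s => by simpa using h _
  have hle := deriv_deriv_nonpos_of_isLocalMax (hline 0).continuousAt hmax
  rw [funext fun s => (hline s).deriv,
    (hasDerivAt_comp_line (differentiable_pd hf i) i x 0).deriv] at hle
  simpa using hle

theorem pd_sum_mul {f : Fin 3 → (Fin 3 → ℝ) → ℝ} (hf : ∀ k, Differentiable ℝ (f k))
    (v : Fin 3 → ℝ) (i : Fin 3) :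
    pd i (fun y => ∑ k, v k * f k y) = fun x => ∑ k, v k * pd i (f k) x := by
  funext x
  have h := HasFDerivAt.fun_sum (u := Finset.univ)
    fun k _ => ((hf k x).hasFDerivAt.const_mul (v k))
  simp [pd, h.fderiv]

/-- A continuous periodic function attains its maximum over `ℝ³ × [0, t]`. -/
theorem exists_forall_le_of_periodic {φ : (Fin 3 → ℝ) × ℝ → ℝ} {t : ℝ} (ht : 0 ≤ t)
    (hφ : ContinuousOn φ (Set.univ ×ˢ Set.Icc 0 t))
    (hper : ∀ (x : Fin 3 → ℝ) (s : ℝ) (n : Fin 3 → ℤ),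
      φ (x + fun i => (n i : ℝ), s) = φ (x, s)) :
    ∃ x₀, ∃ t₀ ∈ Set.Icc 0 t, ∀ x, ∀ s ∈ Set.Icc 0 t, φ (x, s) ≤ φ (x₀, t₀) := by
  have hK : IsCompact ((Set.Icc 0 1 : Set (Fin 3 → ℝ)) ×ˢ Set.Icc 0 t) :=
    isCompact_Icc.prod isCompact_Icc
  obtain ⟨⟨x₀, t₀⟩, hmem, hmax⟩ := hK.exists_isMaxOn
    ⟨(0, 0), ⟨by simp, ⟨le_rfl, ht⟩⟩⟩
    (hφ.mono (Set.prod_mono_left (Set.subset_univ _)))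
  refine ⟨x₀, t₀, hmem.2, fun x s hs => ?_⟩
  rw [← hper x s fun i => -⌊x i⌋]
  refine hmax ⟨⟨fun i => ?_, fun i => ?_⟩, hs⟩
  · simpa using Int.floor_le (x i)
  · have := (Int.lt_floor_add_one (x i)).le
    simp only [Pi.add_apply, Int.cast_neg, Pi.one_apply]
    linarith

/-- Maximum principle for the transported Ginzburg–Landau heat flow
`∂_t d + u·∇d = Δd − (|d|²−1)d` with `div u = 0`: if `|d(·,0)| ≤ 1` then `|d(·,t)| ≤ 1`
for all `t ∈ [0,T]`. -/
theorem transported_GL_maximum_principle (T : ℝ) (hT : 0 < T)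
    (u d : (Fin 3 → ℝ) × ℝ → (Fin 3 → ℝ))
    (hu : ContDiffOn ℝ (⊤ : ℕ∞) u (Set.univ ×ˢ Set.Icc 0 T))
    (hd : ContDiffOn ℝ (⊤ : ℕ∞) d (Set.univ ×ˢ Set.Icc 0 T))
    (huper : ∀ (x : Fin 3 → ℝ) (t : ℝ) (n : Fin 3 → ℤ),
      u (x + fun i => (n i : ℝ), t) = u (x, t))
    (hdper : ∀ (x : Fin 3 → ℝ) (t : ℝ) (n : Fin 3 → ℤ),
      d (x + fun i => (n i : ℝ), t) = d (x, t))
    (hdiv : ∀ (x : Fin 3 → ℝ), ∀ t ∈ Set.Icc (0 : ℝ) T,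
      ∑ i : Fin 3, pd i (fun y => u (y, t) i) x = 0)
    (heq : ∀ (x : Fin 3 → ℝ), ∀ t ∈ Set.Ioc (0 : ℝ) T, ∀ k : Fin 3,
      deriv (fun s => d (x, s) k) t
        + (∑ i : Fin 3, u (x, t) i * pd i (fun y => d (y, t) k) x)
      = (∑ i : Fin 3, pd i (pd i (fun y => d (y, t) k)) x)
        - ((∑ m : Fin 3, (d (x, t) m) ^ 2) - 1) * d (x, t) k)
    (hinit : ∀ x : Fin 3 → ℝ, Real.sqrt (∑ k : Fin 3, (d (x, 0) k) ^ 2) ≤ 1) :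
    ∀ (x : Fin 3 → ℝ), ∀ t ∈ Set.Icc (0 : ℝ) T,
      Real.sqrt (∑ k : Fin 3, (d (x, t) k) ^ 2) ≤ 1 := by
  have hslice : ∀ t ∈ Set.Icc (0 : ℝ) T, ∀ k : Fin 3, ContDiff ℝ 2 fun y => d (y, t) k := by
    intro t ht k
    have h : ContDiff ℝ (⊤ : ℕ∞) fun y : Fin 3 → ℝ => d (y, t) := by
      rw [← contDiffOn_univ]
      exact hd.comp (contDiff_id.prodMk contDiff_const).contDiffOn fun y _ => ⟨trivial, ht⟩
    exact contDiff_infty.1 (contDiff_pi.1 h k) 2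
  have htime : ∀ x, ∀ t ∈ Set.Ioo (0 : ℝ) T, ∀ k : Fin 3,
      DifferentiableAt ℝ (fun s => d (x, s) k) t := by
    intro x t ht k
    have h : DifferentiableAt ℝ d (x, t) :=
      (hd.differentiableOn (by simp)).differentiableAt
        (prod_mem_nhds Filter.univ_mem (Icc_mem_nhds ht.1 ht.2))
    have h' : DifferentiableAt ℝ (fun s : ℝ => d (x, s)) t :=
      h.comp t ((differentiableAt_const x).prodMk differentiableAt_id)
    exact differentiableAt_pi.1 h' k
  set φ : (Fin 3 → ℝ) × ℝ → ℝ := fun p => ∑ k : Fin 3, (d p k) ^ 2 with hφdef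
  have hφ : ContinuousOn φ (Set.univ ×ˢ Set.Icc 0 T) :=
    continuousOn_finsetSum _ fun k _ => (continuousOn_pi.1 hd.continuousOn k).pow 2
  have hbound : ∀ t ∈ Set.Ico (0 : ℝ) T, ∀ x, φ (x, t) ≤ 1 := by
    intro t ht x
    obtain ⟨x₀, t₀, ht₀, hmax⟩ := exists_forall_le_of_periodic ht.1
      (hφ.mono (Set.prod_mono_right (Set.Icc_subset_Icc_right ht.2.le)))
      (fun x s n => by simp only [hφdef, hdper])
    refine (hmax x t ⟨ht.1, le_rfl⟩).trans ?_
    by_contra! hgt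
    have hpos : 0 < t₀ := by
      refine lt_of_le_of_ne ht₀.1 ?_
      rintro rfl
      exact absurd (Real.sqrt_le_one.1 (hinit x₀)) (not_le.2 hgt)
    have htT : t₀ < T := ht₀.2.trans_lt ht.2
    have htI : t₀ ∈ Set.Icc (0 : ℝ) T := ⟨hpos.le, htT.le⟩
    -- Testing against the frozen vector `v` makes the problem linear in `d`.
    set v := d (x₀, t₀) with hv
    have hle : ∀ y, ∀ s ∈ Set.Icc 0 t,
        ∑ k, v k * d (y, s) k ≤ ∑ k, v k * d (x₀, t₀) k := by
      intro y s hs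
      have h := hmax y s hs
      simp only [hφdef, ← hv, Fin.sum_univ_three] at h ⊢
      nlinarith [sq_nonneg (v 0 - d (y, s) 0), sq_nonneg (v 1 - d (y, s) 1),
        sq_nonneg (v 2 - d (y, s) 2)]
    have hslice₀ := hslice t₀ htI
    have hsmooth : ContDiff ℝ 2 fun y => ∑ k, v k * d (y, t₀) k :=
      ContDiff.sum fun k _ => contDiff_const.mul (hslice₀ k)
    have hspace : ∀ y, ∑ k, v k * d (y, t₀) k ≤ ∑ k, v k * d (x₀, t₀) k :=
      fun y => hle y t₀ ht₀
    have hpd := pd_sum_mul (fun k => (hslice₀ k).differentiable (by norm_num)) v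
    have hgrad : ∀ i, ∑ k, v k * pd i (fun y => d (y, t₀) k) x₀ = 0 := fun i => by
      rw [← congrFun (hpd i) x₀]
      exact pd_eq_zero_of_forall_le hspace i
    have hlap : ∀ i, ∑ k, v k * pd i (pd i fun y => d (y, t₀) k) x₀ ≤ 0 := fun i => by
      have h := pd_pd_nonpos_of_forall_le hsmooth hspace i
      rwa [hpd i, pd_sum_mul (fun k => differentiable_pd (hslice₀ k) i) v i] at h
    have hdt : 0 ≤ ∑ k, v k * deriv (fun s => d (x₀, s) k) t₀ := by
      have hD : HasDerivAt (fun s => ∑ k, v k * d (x₀, s) k)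
          (∑ k, v k * deriv (fun s => d (x₀, s) k) t₀) t₀ :=
        HasDerivAt.fun_sum fun k _ => (htime x₀ t₀ ⟨hpos, htT⟩ k).hasDerivAt.const_mul (v k)
      rw [← hD.deriv]
      exact deriv_nonneg_of_forall_le_left hpos hD.differentiableAt
        fun s hs => hle x₀ s ⟨hs.1.le, hs.2.le.trans ht₀.2⟩
    have hflow : ∑ k, v k * deriv (fun s => d (x₀, s) k) t₀
          + ∑ i, u (x₀, t₀) i * ∑ k, v k * pd i (fun y => d (y, t₀) k) x₀
        = ∑ i, ∑ k, v k * pd i (pd i fun y => d (y, t₀) k) x₀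
          - (φ (x₀, t₀) - 1) * φ (x₀, t₀) := by
      have h := fun k => heq x₀ t₀ ⟨hpos, htT.le⟩ k
      simp only [hφdef, ← hv, Fin.sum_univ_three] at h ⊢
      linear_combination v 0 * h 0 + v 1 * h 1 + v 2 * h 2
    simp only [hgrad, mul_zero, Finset.sum_const_zero, add_zero] at hflow
    have hlap' := Finset.sum_nonpos fun i (_ : i ∈ Finset.univ) => hlap i
    nlinarith
  intro x t ht
  refine Real.sqrt_le_one.2 ?_
  have hcont : ContinuousOn (fun s => φ (x, s)) (Set.Icc 0 T) :=
    hφ.comp (by fun_prop) fun s hs => ⟨trivial, hs⟩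
  have hcl : closure (Set.Ico 0 T) = Set.Icc 0 T := closure_Ico hT.ne
  exact ContinuousWithinAt.closure_le (hcl ▸ ht)
    ((hcont t ht).mono Set.Ico_subset_Icc_self) continuousWithinAt_const
    fun s hs => hbound s hs x
end
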